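/- Partial gauge fixing of ambient representatives: let ℓ ≥ 1 be an integer and Φ₀ a smooth function on ℝ^{n+2} ∖ {0} homogeneous of degree ℓ − n/2. Define recursively Φ_k := −(1/(4k(ℓ−k))) □ Φ_{k−1} for k = 1, …, ℓ−1, and set Φ := Σ_{k=0}^{ℓ−1} (X²)^k Φ_k. Then □Φ = (X²)^{ℓ−1} □Φ_{ℓ−1}; in particular □Φ is divisible by (X²)^{ℓ−1}. -/

import Mathlib

noncomputable section

/-- Partial derivative in coordinate direction `A` of a function on `ℝ^m`. -/
def pd {m : ℕ} (A : Fin m) (f : (Fin m → ℝ) → ℝ) : (Fin m → ℝ) → ℝ :=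
  fun x => fderiv ℝ f x (Pi.single A 1)

/-- The Euler operator `X·∂`. -/
def euler {m : ℕ} (f : (Fin m → ℝ) → ℝ) : (Fin m → ℝ) → ℝ :=
  fun x => ∑ A, x A * pd A f x

/-- The Laplacian `□ = η^{AB} ∂_A ∂_B` for the diagonal metric with entries `ε`. -/
def lap {m : ℕ} (ε : Fin m → ℝ) (f : (Fin m → ℝ) → ℝ) : (Fin m → ℝ) → ℝ :=
  fun x => ∑ A, ε A * pd A (pd A f) x

/-- `X² = η_{AB} X^A X^B` for the diagonal metric with entries `ε`. -/
def xsq {m : ℕ} (ε : Fin m → ℝ) (x : Fin m → ℝ) : ℝ :=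
  ∑ A, ε A * x A ^ 2

/-- `ε` is a diagonal metric with all entries `±1` and exactly `q` entries equal to `-1`,
i.e. a nondegenerate symmetric bilinear form of signature `(m - q, q)`. -/
def isSig {m : ℕ} (ε : Fin m → ℝ) (q : ℕ) : Prop :=
  (∀ A, ε A = 1 ∨ ε A = -1) ∧ Nat.card {A : Fin m // ε A = -1} = q

/-- The flat Thomas-D operator `D_A = 2(X·∂ + c)∂_A - X_A □` (with `c = n/2`). -/
def thomasD {m : ℕ} (ε : Fin m → ℝ) (c : ℝ) (A : Fin m) (f : (Fin m → ℝ) → ℝ) :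
    (Fin m → ℝ) → ℝ :=
  fun x => 2 * (euler (pd A f) x + c * pd A f x) - ε A * x A * lap ε f x

/-- The recursively defined coefficients `Φ_k = -(1/(4k(ℓ-k))) □ Φ_{k-1}`, `Φ_0` given. -/
def phiSeq {m : ℕ} (ε : Fin m → ℝ) (ℓ : ℕ) (Φ0 : (Fin m → ℝ) → ℝ) :
    ℕ → (Fin m → ℝ) → ℝ
  | 0 => Φ0
  | k + 1 => fun x =>
      -(1 / (4 * ((k : ℝ) + 1) * ((ℓ : ℝ) - ((k : ℝ) + 1)))) * lap ε (phiSeq ε ℓ Φ0 k) x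

section PartialDerivatives

open scoped ContDiff

variable {m : ℕ} {U : Set (Fin m → ℝ)} {f g : (Fin m → ℝ) → ℝ} {x : Fin m → ℝ}
  {ε : Fin m → ℝ} {w : ℝ}

theorem ContDiffOn.differentiableAt_of_isOpen (hf : ContDiffOn ℝ ∞ f U) (hU : IsOpen U)
    (hx : x ∈ U) : DifferentiableAt ℝ f x :=
  (hf.contDiffAt (hU.mem_nhds hx)).differentiableAt (by simp)

theorem ContDiffOn.pd (hf : ContDiffOn ℝ ∞ f U) (hU : IsOpen U) (A : Fin m) :
    ContDiffOn ℝ ∞ (pd A f) U :=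
  (hf.fderiv_of_isOpen hU (m := ∞) (by simp)).clm_apply contDiffOn_const

theorem ContDiffOn.lap (hf : ContDiffOn ℝ ∞ f U) (hU : IsOpen U) (ε : Fin m → ℝ) :
    ContDiffOn ℝ ∞ (lap ε f) U :=
  ContDiffOn.sum fun A _ => contDiffOn_const.mul ((hf.pd hU A).pd hU A)

theorem contDiff_xsq (ε : Fin m → ℝ) : ContDiff ℝ ∞ (xsq ε) :=
  ContDiff.sum fun A _ => contDiff_const.mul ((contDiff_apply ℝ ℝ A).pow 2)

theorem Set.EqOn.pd (h : Set.EqOn f g U) (hU : IsOpen U) (A : Fin m) :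
    Set.EqOn (pd A f) (pd A g) U := fun x hx => by
  simp only [_root_.pd, (h.eventuallyEq_of_mem (hU.mem_nhds hx)).fderiv_eq]

theorem pd_add (A : Fin m) (hf : DifferentiableAt ℝ f x) (hg : DifferentiableAt ℝ g x) :
    pd A (fun y => f y + g y) x = pd A f x + pd A g x := by
  simp [pd, fderiv_fun_add hf hg]

theorem pd_mul (A : Fin m) (hf : DifferentiableAt ℝ f x) (hg : DifferentiableAt ℝ g x) :
    pd A (fun y => f y * g y) x = f x * pd A g x + g x * pd A f x := by
  simp [pd, fderiv_fun_mul hf hg]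

theorem pd_const_mul (A : Fin m) (c : ℝ) (hf : DifferentiableAt ℝ f x) :
    pd A (fun y => c * f y) x = c * pd A f x := by
  simp [pd, fderiv_const_mul hf]

theorem pd_sum {ι : Type*} (A : Fin m) (s : Finset ι) {F : ι → (Fin m → ℝ) → ℝ}
    (hF : ∀ i ∈ s, DifferentiableAt ℝ (F i) x) :
    pd A (fun y => ∑ i ∈ s, F i y) x = ∑ i ∈ s, pd A (F i) x := by
  simp [pd, fderiv_fun_sum hF]

theorem pd_coord (A B : Fin m) : pd A (fun y => y B) x = if B = A then 1 else 0 := by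
  have h : HasFDerivAt (fun y : Fin m → ℝ => y B)
      (ContinuousLinearMap.proj B : (Fin m → ℝ) →L[ℝ] ℝ) x := hasFDerivAt_apply B x
  simp [pd, h.fderiv, Pi.single_apply]

theorem pd_xsq (A : Fin m) : pd A (xsq ε) x = 2 * (ε A * x A) := by
  have hd : ∀ B : Fin m, DifferentiableAt ℝ (fun y : Fin m → ℝ => y B) x :=
    fun B => differentiableAt_apply B x
  unfold xsq
  simp only [pow_two]
  rw [pd_sum A _ fun B _ => ((hd B).fun_mul (hd B)).const_mul _]
  simp only [pd_const_mul A _ ((hd _).fun_mul (hd _)), pd_mul A (hd _) (hd _), pd_coord]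
  rw [Finset.sum_eq_single A (fun B _ h => by simp [h]) (by simp), if_pos rfl]
  ring

theorem pd_comm (hf : ContDiffOn ℝ ∞ f U) (hU : IsOpen U) (hx : x ∈ U) (A B : Fin m) :
    pd A (pd B f) x = pd B (pd A f) x := by
  have hc := hf.contDiffAt (hU.mem_nhds hx)
  have hd : DifferentiableAt ℝ (fderiv ℝ f) x :=
    (hc.fderiv_right (m := ∞) (by simp)).differentiableAt (by simp)
  have hs : IsSymmSndFDerivAt ℝ f x := hc.isSymmSndFDerivAt (by simpa using ENat.LEInfty.out)
  have key : ∀ C D : Fin m, pd C (pd D f) x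
      = fderiv ℝ (fderiv ℝ f) x (Pi.single C 1) (Pi.single D 1) := fun C D => by
    change fderiv ℝ (fun y => fderiv ℝ f y (Pi.single D 1)) x (Pi.single C 1) = _
    rw [fderiv_clm_apply hd (differentiableAt_const _)]
    simp
  rw [key, key, hs.eq]

/-- A partial derivative lowers the degree of homogeneity by one. -/
theorem euler_pd (hf : ContDiffOn ℝ ∞ f U) (hU : IsOpen U)
    (h : ∀ x ∈ U, euler f x = w * f x) (A : Fin m) :
    ∀ x ∈ U, euler (pd A f) x = (w - 1) * pd A f x := by
  intro x hx
  have hd : ∀ B : Fin m, DifferentiableAt ℝ (fun y : Fin m → ℝ => y B) x :=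
    fun B => differentiableAt_apply B x
  have hp : ∀ B, DifferentiableAt ℝ (pd B f) x :=
    fun B => (hf.pd hU B).differentiableAt_of_isOpen hU hx
  have h1 : pd A (euler f) x = pd A (fun y => w * f y) x :=
    Set.EqOn.pd (g := fun y => w * f y) h hU A hx
  unfold euler at h1
  rw [pd_const_mul A w (hf.differentiableAt_of_isOpen hU hx),
    pd_sum A _ fun B _ => (hd B).fun_mul (hp B)] at h1
  simp only [pd_mul A (hd _) (hp _), pd_coord, pd_comm hf hU hx A, Finset.sum_add_distrib] at h1
  simp only [mul_ite, mul_one, mul_zero, Finset.sum_ite_eq', Finset.mem_univ, if_true] at h1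
  unfold euler
  linarith

theorem euler_const_mul (c : ℝ) (hf : DifferentiableAt ℝ f x) :
    euler (fun y => c * f y) x = c * euler f x := by
  simp only [euler, pd_const_mul _ c hf, Finset.mul_sum]
  exact Finset.sum_congr rfl fun A _ => by ring

theorem euler_sum {ι : Type*} (s : Finset ι) {F : ι → (Fin m → ℝ) → ℝ}
    (hF : ∀ i ∈ s, DifferentiableAt ℝ (F i) x) :
    euler (fun y => ∑ i ∈ s, F i y) x = ∑ i ∈ s, euler (F i) x := by
  simp only [euler, pd_sum _ s hF, Finset.mul_sum]
  exact Finset.sum_comm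

/-- The Laplacian lowers the degree of homogeneity by two. -/
theorem euler_lap (hf : ContDiffOn ℝ ∞ f U) (hU : IsOpen U)
    (h : ∀ x ∈ U, euler f x = w * f x) (ε : Fin m → ℝ) :
    ∀ x ∈ U, euler (lap ε f) x = (w - 2) * lap ε f x := by
  intro x hx
  have hp : ∀ B, DifferentiableAt ℝ (pd B (pd B f)) x :=
    fun B => ((hf.pd hU B).pd hU B).differentiableAt_of_isOpen hU hx
  unfold lap
  rw [euler_sum _ fun B _ => (hp B).const_mul _, Finset.mul_sum]
  refine Finset.sum_congr rfl fun B _ => ?_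
  rw [euler_const_mul _ (hp B), euler_pd (hf.pd hU B) hU (euler_pd hf hU h B) B x hx]
  ring

theorem lap_add (hf : ContDiffOn ℝ ∞ f U) (hg : ContDiffOn ℝ ∞ g U) (hU : IsOpen U)
    (hx : x ∈ U) : lap ε (fun y => f y + g y) x = lap ε f x + lap ε g x := by
  simp only [lap, ← Finset.sum_add_distrib]
  refine Finset.sum_congr rfl fun A _ => ?_
  have h1 : Set.EqOn (pd A fun y => f y + g y) (fun y => pd A f y + pd A g y) U := fun y hy =>
    pd_add A (hf.differentiableAt_of_isOpen hU hy) (hg.differentiableAt_of_isOpen hU hy)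
  rw [h1.pd hU A hx, pd_add A ((hf.pd hU A).differentiableAt_of_isOpen hU hx)
    ((hg.pd hU A).differentiableAt_of_isOpen hU hx), mul_add]

theorem pd_xsq_mul (A : Fin m) (hf : DifferentiableAt ℝ f x) :
    pd A (fun y => xsq ε y * f y) x = xsq ε x * pd A f x + 2 * ε A * (x A * f x) := by
  rw [pd_mul A ((contDiff_xsq ε).differentiable (by simp) x) hf, pd_xsq]
  ring

theorem euler_xsq_mul (hf : DifferentiableAt ℝ f x) :
    euler (fun y => xsq ε y * f y) x = xsq ε x * (euler f x + 2 * f x) := by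
  simp only [euler, pd_xsq_mul _ hf, mul_add, Finset.sum_add_distrib, Finset.mul_sum]
  congr 1
  · exact Finset.sum_congr rfl fun A _ => by ring
  · rw [xsq, Finset.sum_mul]
    exact Finset.sum_congr rfl fun A _ => by ring

theorem lap_xsq_mul (hε : ∀ A, ε A * ε A = 1) (hf : ContDiffOn ℝ ∞ f U) (hU : IsOpen U)
    (hx : x ∈ U) :
    lap ε (fun y => xsq ε y * f y) x
      = xsq ε x * lap ε f x + 4 * euler f x + 2 * m * f x := by
  have hd : DifferentiableAt ℝ f x := hf.differentiableAt_of_isOpen hU hx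
  have key : ∀ A, pd A (pd A fun y => xsq ε y * f y) x
      = xsq ε x * pd A (pd A f) x + 4 * ε A * (x A * pd A f x) + 2 * ε A * f x := fun A => by
    have h1 : Set.EqOn (pd A fun y => xsq ε y * f y)
        (fun y => xsq ε y * pd A f y + 2 * ε A * (y A * f y)) U := fun y hy =>
      pd_xsq_mul A (hf.differentiableAt_of_isOpen hU hy)
    have hp : DifferentiableAt ℝ (pd A f) x := (hf.pd hU A).differentiableAt_of_isOpen hU hx
    have hc : DifferentiableAt ℝ (fun y : Fin m → ℝ => y A) x := differentiableAt_apply A x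
    have hu : DifferentiableAt ℝ (xsq ε) x := (contDiff_xsq ε).differentiable (by simp) x
    rw [h1.pd hU A hx, pd_add A (hu.fun_mul hp) ((hc.fun_mul hd).const_mul _), pd_xsq_mul A hp,
      pd_const_mul A _ (hc.fun_mul hd), pd_mul A hc hd, pd_coord, if_pos rfl]
    ring
  have hm : 2 * m * f x = ∑ _A : Fin m, 2 * f x := by
    simp
    ring
  rw [hm]
  simp only [lap, euler, key, Finset.mul_sum, ← Finset.sum_add_distrib]
  refine Finset.sum_congr rfl fun A _ => ?_
  linear_combination (4 * (x A * pd A f x) + 2 * f x) * hε A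

theorem ContDiffOn.xsq_pow_mul (hf : ContDiffOn ℝ ∞ f U) (ε : Fin m → ℝ) (k : ℕ) :
    ContDiffOn ℝ ∞ (fun y => xsq ε y ^ k * f y) U :=
  ((contDiff_xsq ε).pow k).contDiffOn.mul hf

theorem xsq_pow_succ_mul (k : ℕ) :
    (fun y => xsq ε y ^ (k + 1) * f y) = fun y => xsq ε y * (xsq ε y ^ k * f y) := by
  funext y
  ring

theorem euler_xsq_pow_mul (hf : ContDiffOn ℝ ∞ f U) (hU : IsOpen U)
    (h : ∀ x ∈ U, euler f x = w * f x) (k : ℕ) :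
    ∀ x ∈ U, euler (fun y => xsq ε y ^ k * f y) x = (w + 2 * k) * (xsq ε x ^ k * f x) := by
  intro x hx
  induction k with
  | zero => simpa using h x hx
  | succ k ih =>
    rw [xsq_pow_succ_mul,
      euler_xsq_mul ((hf.xsq_pow_mul ε k).differentiableAt_of_isOpen hU hx), ih]
    push_cast
    ring

/-- The `sl(2)` relation for the Laplacian of `(X²)^(k+1) f` with `f` homogeneous. -/
theorem lap_xsq_pow_succ_mul (hε : ∀ A, ε A * ε A = 1) (hf : ContDiffOn ℝ ∞ f U)
    (hU : IsOpen U) (h : ∀ x ∈ U, euler f x = w * f x) (k : ℕ) (hx : x ∈ U) :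
    lap ε (fun y => xsq ε y ^ (k + 1) * f y) x
      = xsq ε x ^ (k + 1) * lap ε f x
        + (k + 1) * (4 * w + 2 * m + 4 * k) * (xsq ε x ^ k * f x) := by
  induction k with
  | zero =>
    simp only [zero_add, pow_one]
    rw [lap_xsq_mul hε hf hU hx, h x hx]
    push_cast
    ring
  | succ k ih =>
    rw [xsq_pow_succ_mul, lap_xsq_mul hε (hf.xsq_pow_mul ε (k + 1)) hU hx, ih,
      euler_xsq_pow_mul hf hU h (k + 1) x hx]
    push_cast
    ring

theorem ContDiffOn.phiSeq (hf : ContDiffOn ℝ ∞ f U) (hU : IsOpen U) (ε : Fin m → ℝ)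
    (ℓ k : ℕ) : ContDiffOn ℝ ∞ (phiSeq ε ℓ f k) U := by
  induction k with
  | zero => exact hf
  | succ k ih => exact contDiffOn_const.mul (ih.lap hU ε)

theorem euler_phiSeq (hf : ContDiffOn ℝ ∞ f U) (hU : IsOpen U)
    (h : ∀ x ∈ U, euler f x = w * f x) (ε : Fin m → ℝ) (ℓ k : ℕ) :
    ∀ x ∈ U, euler (phiSeq ε ℓ f k) x = (w - 2 * k) * phiSeq ε ℓ f k x := by
  induction k with
  | zero => simpa [phiSeq] using h
  | succ k ih =>
    intro x hx
    have hk := hf.phiSeq hU ε ℓ k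
    simp only [phiSeq]
    rw [euler_const_mul _ ((hk.lap hU ε).differentiableAt_of_isOpen hU hx),
      euler_lap hk hU ih ε x hx]
    push_cast
    ring

/-- Partial sums of the gauge-fixed representative: each new term cancels the Laplacian of the
previous ones. -/
theorem lap_sum_xsq_pow_mul_phiSeq (hε : ∀ A, ε A * ε A = 1) (hf : ContDiffOn ℝ ∞ f U)
    (hU : IsOpen U) (ℓ : ℕ) (h : ∀ x ∈ U, euler f x = (ℓ + 1 - m / 2) * f x) (j : ℕ)
    (hj : j < ℓ) (hx : x ∈ U) :
    lap ε (fun y => ∑ k ∈ Finset.range (j + 1), xsq ε y ^ k * phiSeq ε ℓ f k y) x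
      = xsq ε x ^ j * lap ε (phiSeq ε ℓ f j) x := by
  induction j with
  | zero => simp
  | succ j ih =>
    have hs := hf.phiSeq hU ε ℓ
    simp only [Finset.sum_range_succ _ (j + 1)]
    rw [lap_add (ContDiffOn.sum fun k _ => (hs k).xsq_pow_mul ε k)
      ((hs (j + 1)).xsq_pow_mul ε (j + 1)) hU hx, ih (by omega),
      lap_xsq_pow_succ_mul hε (hs (j + 1)) hU (euler_phiSeq hf hU h ε ℓ (j + 1)) j hx]
    have hj0 : (j : ℝ) + 1 ≠ 0 := by positivity
    have hℓ0 : (ℓ : ℝ) - (j + 1) ≠ 0 :=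
      sub_ne_zero.2 (by exact_mod_cast hj.ne')
    have hrec : 4 * ((j : ℝ) + 1) * (ℓ - (j + 1)) * phiSeq ε ℓ f (j + 1) x
        = -lap ε (phiSeq ε ℓ f j) x := by
      simp only [phiSeq]
      field_simp
    push_cast
    linear_combination xsq ε x ^ j * hrec

end PartialDerivatives

/-- partial gauge fixing of ambient representatives. For `Φ₀` smooth on
`ℝ^{n+2} ∖ {0}` homogeneous of degree `ℓ - n/2` and `Φ = Σ_{k<ℓ} (X²)^k Φ_k` with
`Φ_k = -(1/(4k(ℓ-k))) □ Φ_{k-1}`, one has `□Φ = (X²)^{ℓ-1} □Φ_{ℓ-1}`; in particular `□Φ`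
is divisible by `(X²)^{ℓ-1}`. -/
theorem lap_of_gauge_fixed_representative
    (n : ℕ) (hn : 1 ≤ n) (ε : Fin (n + 2) → ℝ) (hsig : isSig ε 2)
    (ℓ : ℕ) (hℓ : 1 ≤ ℓ) (Φ0 : (Fin (n + 2) → ℝ) → ℝ)
    (hΦ0 : ContDiffOn ℝ (⊤ : ℕ∞) Φ0 {x | x ≠ 0})
    (hom : ∀ x : Fin (n + 2) → ℝ, x ≠ 0 →
      euler Φ0 x = ((ℓ : ℝ) - (n : ℝ) / 2) * Φ0 x) :
    ∀ x : Fin (n + 2) → ℝ, x ≠ 0 →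
      lap ε (fun y => ∑ k ∈ Finset.range ℓ, xsq ε y ^ k * phiSeq ε ℓ Φ0 k y) x
        = xsq ε x ^ (ℓ - 1) * lap ε (phiSeq ε ℓ Φ0 (ℓ - 1)) x := by
  intro x hx
  obtain ⟨j, rfl⟩ : ∃ j, ℓ = j + 1 := ⟨ℓ - 1, by omega⟩
  refine lap_sum_xsq_pow_mul_phiSeq (fun A => ?_) hΦ0 isOpen_ne _ (fun y hy => ?_) j
    j.lt_succ_self hx
  · rcases hsig.1 A with h | h <;> simp [h]
  · rw [hom y hy]
    push_cast
    ring

end
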